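/- arXiv:2208.03304 — 2 statements merged into one kernel-verified Lean document; each statement's English description precedes it below -/
import Mathlib

section
/- Let K be a totally real number field of degree n with 2 ≤ n ≤ 11 over ℚ, with discriminant Δ_K and regulator R_K. Then the number n_K of homothety classes of perfect unary forms over K satisfies n_K ≤ exp(n·√(η² + ρ)) · |Δ_K| · (2/π)^{2n} · Γ(2 + n/2)^4, where η = (√(n-1)/2) · R_K^{1/n} and ρ = (4/(n-1)) · ( log( n^{-n/2} · √|Δ_K| · (2/π)^{n/2} · Γ(2 + n/2) ) )². -/
open NumberField Real

/-- An element of a number field is *totally positive* if it is positive under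
every real embedding. -/
def TotPos {K : Type*} [Field K] (a : K) : Prop := ∀ φ : K →+* ℝ, 0 < φ a

/-- The value of the trace form `Tr_{K/ℚ}(a x²)` at an algebraic integer `x`. -/
noncomputable def trForm {K : Type*} [Field K] [NumberField K] (a : K) (x : 𝓞 K) : ℚ :=
  Algebra.trace ℚ K (a * (x : K) ^ 2)

/-- `μ(a)`: the minimum of `Tr_{K/ℚ}(a x²)` over nonzero `x ∈ 𝓞 K`. -/
noncomputable def muMin {K : Type*} [Field K] [NumberField K] (a : K) : ℝ :=
  sInf {t : ℝ | ∃ x : 𝓞 K, x ≠ 0 ∧ (trForm a x : ℝ) = t}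

/-- `M(a)`: the set of algebraic integers attaining `μ(a)`. -/
def MinVecs {K : Type*} [Field K] [NumberField K] (a : K) : Set (𝓞 K) :=
  {x | ((trForm a x : ℚ) : ℝ) = muMin a}

/-- A totally positive `a` is *perfect* if it is the unique totally positive element `b`
with `Tr(b x²) = μ(a)` for all `x ∈ M(a)`. -/
def IsPerfectForm {K : Type*} [Field K] [NumberField K] (a : K) : Prop :=
  TotPos a ∧ ∀ b : K, TotPos b → (∀ x ∈ MinVecs a, ((trForm b x : ℚ) : ℝ) = muMin a) → b = a

/-- `a ~ a'` : equivalence by squares of units. -/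
def UnitEquiv {K : Type*} [Field K] [NumberField K] (a a' : K) : Prop :=
  ∃ u : (𝓞 K)ˣ, a' = a * ((u : 𝓞 K) : K) ^ 2

/-- Homothety: `a` and `b` are homothetic if `λ a ~ b` for some positive rational `λ`. -/
def Homothetic {K : Type*} [Field K] [NumberField K] (a b : K) : Prop :=
  ∃ q : ℚ, 0 < q ∧ UnitEquiv ((q : K) * a) b

/-- The number of homothety classes of perfect unary forms of `K`. -/
noncomputable def numClasses (K : Type*) [Field K] [NumberField K] : ℕ :=
  Nat.card (Quot (fun a b : {a : K // IsPerfectForm a} => Homothetic (a : K) (b : K)))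

/-- `K` is `A`-reducible if minimal vectors of totally positive elements have norm at most `A`. -/
def IsAReducible (K : Type*) [Field K] [NumberField K] (A : ℝ) : Prop :=
  ∀ a : K, TotPos a → ∀ x ∈ MinVecs a, |(Algebra.norm ℚ (x : K) : ℝ)| ≤ A

/-- `K` is totally real if every infinite place is real. -/
def TotallyReal (K : Type*) [Field K] [NumberField K] : Prop :=
  ∀ v : NumberField.InfinitePlace K, v.IsReal

section

open InfinitePlace mixedEmbedding Module MeasureTheory
open scoped Classical

variable {K : Type*} [Field K] [NumberField K]

theorem ratCast_trace_eq_sum_real [IsTotallyReal K] (x : K) :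
    ((Algebra.trace ℚ K x : ℚ) : ℝ) =
      ∑ w : {w : InfinitePlace K // IsReal w}, (mixedEmbedding K x).1 w := by
  let e : (K →ₐ[ℚ] ℂ) ≃ {w : InfinitePlace K // IsReal w} :=
    (RingHom.equivRatAlgHom K ℂ).symm.trans <|
      (Equiv.subtypeUnivEquiv IsTotallyReal.complexEmbedding_isReal).symm.trans mkReal
  have h := trace_eq_sum_embeddings (K := ℚ) (E := ℂ) (x := x)
  rw [← e.sum_comp, ← Complex.ofReal_inj, Complex.ofReal_ratCast, Complex.ofReal_sum]
  refine h.trans (Finset.sum_congr rfl fun σ _ ↦ ?_)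
  rw [mixedEmbedding_apply_isReal, embedding_of_isReal_apply]
  exact (congrArg (· x) (embedding_mk_eq_of_isReal
    (IsTotallyReal.complexEmbedding_isReal (σ : K →+* ℂ)))).symm

theorem trForm_nonneg {a : K} [IsTotallyReal K] (ha : TotPos a) (x : 𝓞 K) :
    0 ≤ (trForm a x : ℝ) := by
  rw [trForm, ratCast_trace_eq_sum_real]
  refine Finset.sum_nonneg fun w _ ↦ ?_
  rw [map_mul, map_pow, Prod.fst_mul, Pi.mul_apply, Prod.pow_fst, Pi.pow_apply]
  have := ha (embedding_of_isReal w.2)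
  rw [mixedEmbedding_apply_isReal]
  positivity

theorem muMin_nonneg [IsTotallyReal K] {a : K} (ha : TotPos a) : 0 ≤ muMin a :=
  Real.sInf_nonneg (by rintro _ ⟨x, -, rfl⟩; exact trForm_nonneg ha x)

theorem muMin_le [IsTotallyReal K] {a : K} (ha : TotPos a) {x : 𝓞 K} (hx : x ≠ 0) :
    muMin a ≤ trForm a x :=
  csInf_le ⟨0, by rintro _ ⟨x, -, rfl⟩; exact trForm_nonneg ha x⟩ ⟨x, hx, rfl⟩

theorem trForm_natCast_mul (m : ℕ) (a : K) (x : 𝓞 K) : trForm (m * a) x = m * trForm a x := by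
  rw [trForm, mul_assoc, ← nsmul_eq_mul, map_nsmul, nsmul_eq_mul, trForm]

theorem IsPerfectForm.muMin_pos [IsTotallyReal K] {a : K} (ha : IsPerfectForm a) :
    0 < muMin a := by
  refine lt_of_le_of_ne (muMin_nonneg ha.1) fun h0 ↦ ?_
  have h1 : TotPos (((2 : ℕ) : K) * a) := fun φ ↦ by
    have := ha.1 φ
    rw [map_mul, map_natCast]
    positivity
  have h2 := ha.2 ((2 : ℕ) * a) h1 fun x hx ↦ by
    have hx' : ((trForm a x : ℚ) : ℝ) = 0 := hx.trans h0.symm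
    rw [trForm_natCast_mul, Rat.cast_mul, hx', mul_zero, h0]
  have h3 : a = 0 := by
    push_cast at h2
    linear_combination h2
  have := ha.1 (embedding_of_isReal (IsTotallyReal.isReal (Classical.arbitrary (InfinitePlace K))))
  simp [h3] at this

theorem IsPerfectForm.ne_zero_of_mem_minVecs [IsTotallyReal K] {a : K} (ha : IsPerfectForm a)
    {x : 𝓞 K} (hx : x ∈ MinVecs a) : x ≠ 0 := by
  rintro rfl
  have h : ((trForm a 0 : ℚ) : ℝ) = muMin a := hx
  have := ha.muMin_pos
  simp [← h, trForm] at this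

theorem exists_pos_rat_totPos_add {a : K} (ha : TotPos a) (c : K) :
    ∃ q : ℚ, 0 < q ∧ TotPos (a + q * c) := by
  have h : ∀ᶠ t : ℝ in nhdsWithin 0 (Set.Ioi 0), ∀ φ : K →+* ℝ, 0 < φ a + t * φ c := by
    rw [Filter.eventually_all]
    intro φ
    have : Filter.Tendsto (fun t : ℝ ↦ φ a + t * φ c) (nhdsWithin 0 (Set.Ioi 0)) (nhds (φ a)) := by
      refine Filter.Tendsto.mono_left ?_ nhdsWithin_le_nhds
      have : Continuous fun t : ℝ ↦ φ a + t * φ c := by fun_prop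
      simpa using this.tendsto 0
    exact this.eventually (lt_mem_nhds (ha φ))
  obtain ⟨u, hu, hu'⟩ := (mem_nhdsGT_iff_exists_Ioo_subset).1 h
  obtain ⟨q, hq0, hq1⟩ := exists_rat_btwn (show (0 : ℝ) < u from hu)
  refine ⟨q, by exact_mod_cast hq0, fun φ ↦ ?_⟩
  have := hu' ⟨hq0, hq1⟩ φ
  simpa using this

theorem IsPerfectForm.span_minVecs_sq {a : K} (ha : IsPerfectForm a) :
    Submodule.span ℚ ((fun x : 𝓞 K ↦ (x : K) ^ 2) '' MinVecs a) = ⊤ := by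
  by_contra hne
  obtain ⟨f, hf0, hf⟩ := Submodule.exists_le_ker_of_lt_top _ (lt_top_iff_ne_top.2 hne)
  obtain ⟨c, hc⟩ := (LinearMap.BilinForm.toDual _ (traceForm_nondegenerate ℚ K)).surjective f
  have hc' : ∀ y, Algebra.trace ℚ K (c * y) = f y := fun y ↦ by
    rw [← hc, LinearMap.BilinForm.toDual_def, Algebra.traceForm_apply]
  obtain ⟨q, hq, hpos⟩ := exists_pos_rat_totPos_add ha.1 c
  have h1 := ha.2 _ hpos fun x hx ↦ by
    have : trForm (a + q * c) x = trForm a x := by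
      have h0 : Algebra.trace ℚ K (c * (x : K) ^ 2) = 0 := by
        rw [hc']
        exact hf (Submodule.subset_span ⟨x, hx, rfl⟩)
      rw [trForm, add_mul, map_add, mul_assoc, ← Rat.smul_def, map_smul, h0, smul_zero, add_zero,
        trForm]
    rw [this]
    exact hx
  have h2 : c = 0 := by
    have : (q : K) * c = 0 := by linear_combination h1
    simpa [hq.ne'] using this
  exact hf0 (by rw [← hc, h2, map_zero])

theorem IsPerfectForm.exists_basis {a : K} (ha : IsPerfectForm a) :
    ∃ (b : Basis (Free.ChooseBasisIndex ℤ (𝓞 K)) ℚ K)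
      (x : Free.ChooseBasisIndex ℤ (𝓞 K) → 𝓞 K),
      ∀ i, x i ∈ MinVecs a ∧ b i = (x i : K) ^ 2 := by
  let b := Basis.ofSpan ha.span_minVecs_sq.ge
  let b' := b.reindex (b.indexEquiv (integralBasis K))
  have h : ∀ i, ∃ x : 𝓞 K, x ∈ MinVecs a ∧ b' i = (x : K) ^ 2 := fun i ↦ by
    obtain ⟨x, hx, h⟩ := Basis.ofSpan_subset ha.span_minVecs_sq.ge
      (Set.mem_range_self ((b.indexEquiv (integralBasis K)).symm i))
    exact ⟨x, hx, by rw [Basis.reindex_apply]; exact h.symm⟩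
  choose x hx using h
  exact ⟨b', x, hx⟩

theorem prod_infinitePlace_eq_prod_real [IsTotallyReal K] {M : Type*} [CommMonoid M]
    (f : {w : InfinitePlace K // IsReal w} → M) :
    ∏ w : InfinitePlace K, f ⟨w, IsTotallyReal.isReal w⟩ = ∏ w, f w :=
  (Equiv.subtypeUnivEquiv (IsTotallyReal.isReal (K := K))).symm.prod_comp f

theorem card_real_eq_finrank [IsTotallyReal K] :
    Fintype.card {w : InfinitePlace K // IsReal w} = finrank ℚ K :=
  (IsTotallyReal.finrank K).symm

theorem prod_le_pow_of_sum_le {ι : Type*} [Fintype ι] [Nonempty ι] {z : ι → ℝ} (hz : ∀ i, 0 ≤ z i)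
    {m : ℝ} (h : ∑ i, z i ≤ Fintype.card ι * m) : ∏ i, z i ≤ m ^ Fintype.card ι := by
  have hc : (0 : ℝ) < Fintype.card ι := by exact_mod_cast Fintype.card_pos
  have := Real.geom_mean_le_arith_mean Finset.univ (fun _ : ι ↦ (1 : ℝ)) z (by simp)
    (by simpa using Fintype.card_pos) (fun i _ ↦ hz i)
  simp only [Real.rpow_one, one_mul, Finset.sum_const, Finset.card_univ, nsmul_eq_mul,
    mul_one] at this
  have hP : 0 ≤ ∏ i, z i := Finset.prod_nonneg fun i _ ↦ hz i
  calc ∏ i, z i = ((∏ i, z i) ^ ((Fintype.card ι : ℝ)⁻¹)) ^ Fintype.card ι := by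
        rw [← Real.rpow_natCast, ← Real.rpow_mul hP, inv_mul_cancel₀ hc.ne', Real.rpow_one]
    _ ≤ m ^ Fintype.card ι := by
        gcongr
        refine this.trans ?_
        rw [div_le_iff₀ hc, mul_comm]
        exact h

theorem muMin_pow_le [IsTotallyReal K] {a : K} (ha : TotPos a) :
    muMin a ^ finrank ℚ K ≤ (finrank ℚ K : ℝ) ^ finrank ℚ K * |(discr K : ℝ)| *
      ∏ w, (mixedEmbedding K a).1 w := by
  by_contra! hlt
  set n := finrank ℚ K with hn
  have hn0 : (0 : ℝ) < n := by exact_mod_cast finrank_pos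
  have hpos : ∀ w, 0 < (mixedEmbedding K a).1 w := fun w ↦ by
    rw [mixedEmbedding_apply_isReal]; exact ha _
  have hμ := muMin_nonneg ha
  let g : {w : InfinitePlace K // IsReal w} → NNReal :=
    fun w ↦ NNReal.sqrt (muMin a / (n * (mixedEmbedding K a).1 w)).toNNReal
  let f : InfinitePlace K → NNReal := fun w ↦ g ⟨w, IsTotallyReal.isReal w⟩
  have hg : ∀ w, (g w : ℝ) ^ 2 = muMin a / (n * (mixedEmbedding K a).1 w) := fun w ↦ by
    have := hpos w
    simp only [g]
    rw [Real.coe_sqrt, Real.sq_sqrt (by positivity), Real.coe_toNNReal _ (by positivity)]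
  have hprod : ((∏ w, f w ^ mult w : NNReal) : ℝ) = ∏ w, (g w : ℝ) := by
    push_cast
    simp only [IsTotallyReal.mult_eq, pow_one]
    exact prod_infinitePlace_eq_prod_real (fun w ↦ (g w : ℝ))
  have key : minkowskiBound K ↑1 < volume (convexBodyLT K f) := by
    rw [convexBodyLT_volume, minkowskiBound, volume_fundamentalDomain_fractionalIdealLatticeBasis,
      Units.val_one, FractionalIdeal.absNorm_one, Rat.cast_one,
      ENNReal.ofReal_one, one_mul, mixedEmbedding.finrank, volume_fundamentalDomain_latticeBasis,
      convexBodyLTFactor, IsTotallyReal.nrComplexPlaces_eq_zero, pow_zero, one_mul, pow_zero,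
      mul_one, ← IsTotallyReal.finrank, mul_comm]
    have : NNReal.sqrt ‖discr K‖₊ < ∏ w, f w ^ mult w := by
      rw [← NNReal.coe_lt_coe, hprod, Real.coe_sqrt, coe_nnnorm, Int.norm_eq_abs]
      refine Real.sqrt_lt_sqrt (abs_nonneg _) ?_ |>.trans_eq
        (Real.sqrt_sq (Finset.prod_nonneg fun _ _ ↦ NNReal.coe_nonneg _))
      rw [← Finset.prod_pow, Finset.prod_congr rfl (fun w _ ↦ hg w), Finset.prod_div_distrib,
        Finset.prod_mul_distrib, Finset.prod_const, Finset.prod_const, Finset.card_univ,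
        card_real_eq_finrank, lt_div_iff₀
          (by have := Finset.prod_pos fun w (_ : w ∈ Finset.univ) ↦ hpos w; positivity)]
      convert hlt using 1
      ring
    rw [ENNReal.coe_pow, ENNReal.coe_ofNat,
      ENNReal.mul_lt_mul_iff_right (a := 2 ^ finrank ℚ K) (by simp) (by simp)]
    exact_mod_cast this
  obtain ⟨x, hx0, hx⟩ := exists_ne_zero_mem_ringOfIntegers_lt K key
  refine absurd (muMin_le ha hx0) (not_le.2 ?_)
  rw [trForm, ratCast_trace_eq_sum_real]
  have : Nonempty {w : InfinitePlace K // IsReal w} :=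
    ⟨⟨Classical.arbitrary (InfinitePlace K), IsTotallyReal.isReal _⟩⟩
  calc ∑ w, (mixedEmbedding K (a * (x : K) ^ 2)).1 w
      < ∑ w : {w : InfinitePlace K // IsReal w}, muMin a / n := by
        refine Finset.sum_lt_sum_of_nonempty Finset.univ_nonempty fun w _ ↦ ?_
        have h1 := hpos w
        have h2 : |(mixedEmbedding K (x : K)).1 w| < g w := by
          rw [mixedEmbedding_apply_isReal, ← Real.norm_eq_abs, norm_embedding_of_isReal]
          exact hx w
        have h3 : (mixedEmbedding K (x : K)).1 w ^ 2 < muMin a / (n * (mixedEmbedding K a).1 w) := by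
          rw [← hg, ← sq_abs]
          gcongr
        rw [lt_div_iff₀ (by positivity)] at h3
        rw [map_mul, map_pow, Prod.fst_mul, Pi.mul_apply, Prod.pow_fst, Pi.pow_apply,
          lt_div_iff₀ hn0]
        linarith
    _ = muMin a := by
        rw [Finset.sum_const, Finset.card_univ, card_real_eq_finrank, nsmul_eq_mul, ← hn,
          mul_div_cancel₀ _ hn0.ne']

theorem latticeBasis_det_eq (b : Free.ChooseBasisIndex ℤ (𝓞 K) → K) :
    (latticeBasis K).det (fun i ↦ mixedEmbedding K (b i)) = (integralBasis K).det b := by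
  rw [Basis.det_apply, Basis.det_apply, ← Rat.coe_castHom, RingHom.map_det]
  congr 1
  ext i j
  simp [Basis.toMatrix_apply, latticeBasis_repr_apply]

theorem one_le_abs_integralBasis_det (b : Basis (Free.ChooseBasisIndex ℤ (𝓞 K)) ℚ K)
    {x : Free.ChooseBasisIndex ℤ (𝓞 K) → 𝓞 K} (hb : ∀ i, b i = x i) :
    1 ≤ |(((integralBasis K).det b : ℚ) : ℝ)| := by
  have h1 : (integralBasis K).det b = (((RingOfIntegers.basis K).det x : ℤ) : ℚ) := by
    rw [Basis.det_apply, Basis.det_apply, ← eq_intCast (Int.castRingHom ℚ), RingHom.map_det]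
    congr 1
    ext i j
    simp [Basis.toMatrix_apply, hb, integralBasis_repr_apply]
  have h2 : (integralBasis K).det b ≠ 0 := ((integralBasis K).isUnit_det b).ne_zero
  rw [h1] at h2 ⊢
  rw [Rat.cast_intCast, ← Int.cast_abs]
  exact_mod_cast Int.one_le_abs (by exact_mod_cast h2)

theorem exists_measurableSet_sqrt_discr_le_volume [IsTotallyReal K]
    (b : Basis (Free.ChooseBasisIndex ℤ (𝓞 K)) ℚ K)
    {x : Free.ChooseBasisIndex ℤ (𝓞 K) → 𝓞 K} (hb : ∀ i, b i = x i) :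
    ∃ D : Set (mixedSpace K), MeasurableSet D ∧
      ENNReal.ofReal (√|(discr K : ℝ)|) ≤ volume D ∧
      ∀ y ∈ D, ∃ t : Free.ChooseBasisIndex ℤ (𝓞 K) → ℝ, (∀ i, 0 < t i ∧ t i ≤ 1) ∧
        y = ∑ i, t i • mixedEmbedding K (x i : K) := by
  have hdet := one_le_abs_integralBasis_det b hb
  obtain ⟨hli, hsp⟩ := ((latticeBasis K).is_basis_iff_det (v := fun i ↦ mixedEmbedding K (b i))).2 (by
    rw [latticeBasis_det_eq, isUnit_iff_ne_zero]
    intro h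
    rw [h] at hdet
    norm_num at hdet)
  let B := Basis.mk hli hsp.ge
  have hB : ∀ i, B i = mixedEmbedding K (x i : K) := fun i ↦ by rw [Basis.mk_apply, hb]
  let c : mixedSpace K := ∑ i, B i
  refine ⟨(fun y ↦ c - y) ⁻¹' ZSpan.fundamentalDomain B,
    (ZSpan.fundamentalDomain_measurableSet B).preimage (by fun_prop), ?_, fun y hy ↦ ?_⟩
  · have hpre : (fun y ↦ c - y) ⁻¹' ZSpan.fundamentalDomain B =
        (fun y ↦ (-1 : ℝ) • y) ⁻¹' ((fun y ↦ c + y) ⁻¹' ZSpan.fundamentalDomain B) := by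
      ext; simp [sub_eq_add_neg]
    rw [hpre, Measure.addHaar_preimage_smul _ (by norm_num), measure_preimage_add, abs_inv,
      abs_pow, abs_neg, abs_one, one_pow, inv_one, ENNReal.ofReal_one, one_mul,
      ZSpan.measure_fundamentalDomain B volume (latticeBasis K),
      volume_fundamentalDomain_latticeBasis, IsTotallyReal.nrComplexPlaces_eq_zero, pow_zero,
      one_mul, show (B : _ → mixedSpace K) = fun i ↦ mixedEmbedding K (b i) from
        funext fun i ↦ Basis.mk_apply ..,
      latticeBasis_det_eq]
    have : ENNReal.ofReal (√|(discr K : ℝ)|) = (NNReal.sqrt ‖discr K‖₊ : NNReal) := by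
      rw [← ENNReal.ofReal_coe_nnreal, Real.coe_sqrt, coe_nnnorm, Int.norm_eq_abs]
    rw [this]
    refine le_mul_of_one_le_left (by positivity) ?_
    rwa [ENNReal.one_le_ofReal]
  · refine ⟨fun i ↦ B.repr y i, fun i ↦ ?_, ?_⟩
    · have := (ZSpan.mem_fundamentalDomain B).1 hy i
      simp only [map_sub, c, map_sum, Basis.repr_self, Finsupp.coe_sub, Pi.sub_apply,
        Finsupp.finsetSum_apply, Finsupp.single_apply, Finset.sum_ite_eq', Finset.mem_univ, if_true,
        Set.mem_Ico] at this
      constructor <;> linarith [this.1, this.2]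
    · conv_lhs => rw [← B.sum_repr y]
      simp [hB]

/-- `y` is a combination, with coefficients in `(0, 1]`, of the squares of minimal vectors of `a`
that form a basis of `K`. -/
def IsMinVecCombination (a : K) (y : mixedSpace K) : Prop :=
  ∃ (b : Basis (Free.ChooseBasisIndex ℤ (𝓞 K)) ℚ K) (x : Free.ChooseBasisIndex ℤ (𝓞 K) → 𝓞 K)
    (t : Free.ChooseBasisIndex ℤ (𝓞 K) → ℝ), (∀ i, x i ∈ MinVecs a ∧ b i = (x i : K) ^ 2) ∧
    (∀ i, 0 < t i ∧ t i ≤ 1) ∧ y = ∑ i, t i • mixedEmbedding K ((x i : K) ^ 2)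

theorem IsPerfectForm.exists_measurableSet [IsTotallyReal K] {a : K} (ha : IsPerfectForm a) :
    ∃ D : Set (mixedSpace K), MeasurableSet D ∧ ENNReal.ofReal (√|(discr K : ℝ)|) ≤ volume D ∧
      ∀ y ∈ D, IsMinVecCombination a y := by
  obtain ⟨b, x, hx⟩ := ha.exists_basis
  obtain ⟨D, hD, hvol, h⟩ := exists_measurableSet_sqrt_discr_le_volume b (x := fun i ↦ x i ^ 2)
    (fun i ↦ (hx i).2)
  refine ⟨D, hD, hvol, fun y hy ↦ ?_⟩
  obtain ⟨t, ht, rfl⟩ := h y hy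
  exact ⟨b, x, t, hx, ht, rfl⟩

/-- The extension of `z ↦ Tr (c z)` to the mixed space of a totally real field. -/
noncomputable def traceFunctional (c : K) : mixedSpace K →ₗ[ℝ] ℝ where
  toFun y := ∑ w, (mixedEmbedding K c).1 w * y.1 w
  map_add' y z := by simp [mul_add, Finset.sum_add_distrib]
  map_smul' r y := by simp [Finset.mul_sum, mul_left_comm]

theorem traceFunctional_apply (c : K) (y : mixedSpace K) :
    traceFunctional c y = ∑ w, (mixedEmbedding K c).1 w * y.1 w := rfl

theorem traceFunctional_mixedEmbedding [IsTotallyReal K] (c z : K) :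
    traceFunctional c (mixedEmbedding K z) = ((Algebra.trace ℚ K (c * z) : ℚ) : ℝ) := by
  rw [traceFunctional_apply, ratCast_trace_eq_sum_real, map_mul]
  rfl

theorem traceFunctional_mul (c d : K) (y : mixedSpace K) :
    traceFunctional c (mixedEmbedding K d * y) = traceFunctional (c * d) y := by
  simp [traceFunctional_apply, mul_assoc]

theorem traceFunctional_sum_smul [IsTotallyReal K] {ι : Type*} [Fintype ι] (c : K) (t : ι → ℝ)
    (x : ι → 𝓞 K) :
    traceFunctional c (∑ i, t i • mixedEmbedding K ((x i : K) ^ 2)) =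
      ∑ i, t i * (trForm c (x i) : ℝ) := by
  simp only [map_sum, map_smul, smul_eq_mul]
  refine Finset.sum_congr rfl fun i _ ↦ ?_
  rw [traceFunctional_mixedEmbedding, trForm]

theorem trForm_mul_sq (c : K) (v x : 𝓞 K) : trForm (c * (v : K) ^ 2) x = trForm c (v * x) := by
  rw [trForm, trForm, show ((v * x : 𝓞 K) : K) = v * x from rfl, mul_pow, mul_assoc]

theorem eq_of_trace_basis_eq {ι : Type*} (b : Basis ι ℚ K) {c d : K}
    (h : ∀ i, Algebra.trace ℚ K (c * b i) = Algebra.trace ℚ K (d * b i)) : c = d := by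
  refine (LinearMap.BilinForm.toDual _ (traceForm_nondegenerate ℚ K)).injective (b.ext fun i ↦ ?_)
  simpa [LinearMap.BilinForm.toDual_def, Algebra.traceForm_apply] using h i

theorem IsPerfectForm.exists_rat_eq_mul_sq [IsTotallyReal K] {a a' : K} (ha : IsPerfectForm a)
    (ha' : IsPerfectForm a') {v : (𝓞 K)ˣ} {y : mixedSpace K} (hy : IsMinVecCombination a y)
    (hy' : IsMinVecCombination a' (mixedEmbedding K (((v : 𝓞 K) : K) ^ 2) * y)) :
    ∃ q : ℚ, 0 < q ∧ a = q * a' * ((v : 𝓞 K) : K) ^ 2 := by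
  obtain ⟨b, x, t, hx, ht, hyt⟩ := hy
  obtain ⟨b', x', t', hx', ht', hyt'⟩ := hy'
  have hμ := ha.muMin_pos
  have hμ' := ha'.muMin_pos
  have hle : ∀ i, muMin a' ≤ (trForm a' (v * x i) : ℝ) := fun i ↦
    muMin_le ha'.1 (mul_ne_zero v.ne_zero (ha.ne_zero_of_mem_minVecs (hx i).1))
  have hle' : ∀ i, muMin a ≤ (trForm a (((v⁻¹ : (𝓞 K)ˣ) : 𝓞 K) * x' i) : ℝ) := fun i ↦
    muMin_le ha.1 (mul_ne_zero v⁻¹.ne_zero (ha'.ne_zero_of_mem_minVecs (hx' i).1))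
  have h1 : muMin a' * ∑ i, t' i = ∑ i, t i * (trForm a' (v * x i) : ℝ) := by
    have := congrArg (traceFunctional a') hyt'
    rw [traceFunctional_mul, hyt, traceFunctional_sum_smul, traceFunctional_sum_smul] at this
    simp only [trForm_mul_sq] at this
    rw [this, Finset.mul_sum]
    refine Finset.sum_congr rfl fun i _ ↦ ?_
    rw [show ((trForm a' (x' i) : ℚ) : ℝ) = muMin a' from (hx' i).1, mul_comm]
  have hyv : y = mixedEmbedding K ((((v⁻¹ : (𝓞 K)ˣ) : 𝓞 K) : K) ^ 2) *
      ∑ i, t' i • mixedEmbedding K ((x' i : K) ^ 2) := by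
    rw [← hyt', ← mul_assoc, ← map_mul, ← mul_pow, ← map_mul, Units.inv_mul, map_one, one_pow,
      map_one, one_mul]
  have h2 : muMin a * ∑ i, t i = ∑ i, t' i * (trForm a (((v⁻¹ : (𝓞 K)ˣ) : 𝓞 K) * x' i) : ℝ) := by
    have := congrArg (traceFunctional a) (hyt.symm.trans hyv)
    rw [traceFunctional_mul, traceFunctional_sum_smul, traceFunctional_sum_smul] at this
    simp only [trForm_mul_sq] at this
    rw [← this, Finset.mul_sum]
    refine Finset.sum_congr rfl fun i _ ↦ ?_
    rw [show ((trForm a (x i) : ℚ) : ℝ) = muMin a from (hx i).1, mul_comm]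
  have h3 : ∑ i, t' i ≤ ∑ i, t i := by
    rw [← mul_le_mul_iff_right₀ hμ, h2, Finset.mul_sum]
    refine Finset.sum_le_sum fun i _ ↦ ?_
    rw [mul_comm]
    exact mul_le_mul_of_nonneg_left (hle' i) (ht' i).1.le
  have h4 : ∀ i ∈ Finset.univ, t i * muMin a' = t i * (trForm a' (v * x i) : ℝ) := by
    refine (Finset.sum_eq_sum_iff_of_le fun i _ ↦
      mul_le_mul_of_nonneg_left (hle i) (ht i).1.le).1 (le_antisymm ?_ ?_)
    · exact Finset.sum_le_sum fun i _ ↦ mul_le_mul_of_nonneg_left (hle i) (ht i).1.le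
    · rw [← h1, ← Finset.sum_mul, mul_comm]
      exact mul_le_mul_of_nonneg_right h3 hμ'.le
  have h5 : ∀ i, (trForm a' (v * x i) : ℝ) = muMin a' := fun i ↦
    (mul_left_cancel₀ (ht i).1.ne' (h4 i (Finset.mem_univ i))).symm
  obtain ⟨i₀⟩ := b.index_nonempty
  have e : ((trForm a (x i₀) : ℚ) : ℝ) = muMin a := (hx i₀).1
  refine ⟨trForm a (x i₀) / trForm a' (v * x i₀), ?_, eq_of_trace_basis_eq b fun i ↦ ?_⟩
  · rw [← Rat.cast_pos (K := ℝ), Rat.cast_div, e, h5]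
    positivity
  · rw [(hx i).2, mul_assoc, mul_assoc, ← Rat.smul_def, map_smul, smul_eq_mul, ← mul_assoc,
      show Algebra.trace ℚ K (a * (x i : K) ^ 2) = trForm a (x i) from rfl,
      show Algebra.trace ℚ K (a' * ((v : 𝓞 K) : K) ^ 2 * (x i : K) ^ 2) = trForm a' (v * x i) from
        trForm_mul_sq .., ← Rat.cast_inj (α := ℝ), Rat.cast_mul, Rat.cast_div, e, h5, h5,
      show ((trForm a (x i) : ℚ) : ℝ) = muMin a from (hx i).1]
    field_simp

theorem IsMinVecCombination.pos [IsTotallyReal K] {a : K} (ha : IsPerfectForm a) {y : mixedSpace K}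
    (hy : IsMinVecCombination a y) (w : {w : InfinitePlace K // IsReal w}) : 0 < y.1 w := by
  obtain ⟨b, x, t, hx, ht, rfl⟩ := hy
  obtain ⟨i₀⟩ := b.index_nonempty
  rw [Prod.fst_sum, Finset.sum_apply]
  refine Finset.sum_pos (fun i _ ↦ ?_) ⟨i₀, Finset.mem_univ _⟩
  rw [Prod.smul_fst, Pi.smul_apply, mixedEmbedding_apply_isReal, map_pow, smul_eq_mul]
  have h1 := (ht i).1
  have h2 : embedding_of_isReal w.2 (x i : K) ≠ 0 := by
    simpa using ha.ne_zero_of_mem_minVecs (hx i).1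
  positivity

theorem norm_eq_prod_abs [IsTotallyReal K] (y : mixedSpace K) :
    mixedEmbedding.norm y = ∏ w, |y.1 w| := by
  rw [mixedEmbedding.norm_apply, ← prod_infinitePlace_eq_prod_real]
  refine Finset.prod_congr rfl fun w _ ↦ ?_
  rw [IsTotallyReal.mult_eq, pow_one, normAtPlace_apply_of_isReal (IsTotallyReal.isReal w),
    Real.norm_eq_abs]

theorem IsMinVecCombination.norm_le [IsTotallyReal K] {a : K} (ha : IsPerfectForm a)
    {y : mixedSpace K} (hy : IsMinVecCombination a y) :
    mixedEmbedding.norm y ≤ (finrank ℚ K : ℝ) ^ finrank ℚ K * |(discr K : ℝ)| := by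
  have hpos := fun w ↦ hy.pos ha w
  obtain ⟨b, x, t, hx, ht, hyt⟩ := hy
  have hμ := ha.muMin_pos
  have hapos : ∀ w, 0 < (mixedEmbedding K a).1 w := fun w ↦ by
    rw [mixedEmbedding_apply_isReal]; exact ha.1 _
  have : Nonempty {w : InfinitePlace K // IsReal w} :=
    ⟨⟨Classical.arbitrary (InfinitePlace K), IsTotallyReal.isReal _⟩⟩
  have h1 : ∑ w, (mixedEmbedding K a).1 w * y.1 w ≤
      Fintype.card {w : InfinitePlace K // IsReal w} * muMin a := by
    rw [← traceFunctional_apply, hyt, traceFunctional_sum_smul, card_real_eq_finrank,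
      finrank_eq_card_basis b, ← nsmul_eq_mul, ← Finset.card_univ, ← Finset.sum_const]
    refine Finset.sum_le_sum fun i _ ↦ ?_
    rw [show ((trForm a (x i) : ℚ) : ℝ) = muMin a from (hx i).1]
    exact mul_le_of_le_one_left hμ.le (ht i).2
  have h2 := (prod_le_pow_of_sum_le (fun w ↦ (mul_pos (hapos w) (hpos w)).le) h1)
  rw [card_real_eq_finrank] at h2
  have h3 := h2.trans (muMin_pow_le ha.1)
  rw [Finset.prod_mul_distrib, mul_comm] at h3
  rw [norm_eq_prod_abs, Finset.prod_congr rfl fun w _ ↦ abs_of_pos (hpos w)]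
  exact le_of_mul_le_mul_right h3 (Finset.prod_pos fun w _ ↦ hapos w)

end

section

open InfinitePlace mixedEmbedding Module MeasureTheory
open scoped Classical

variable {K : Type*} [Field K]

/-- Multiplication of the real coordinates by the absolute values of the conjugates of a unit. -/
noncomputable def absMul (u : (𝓞 K)ˣ) (y : mixedSpace K) : mixedSpace K :=
  (fun w ↦ w.1 ((u : 𝓞 K) : K) * y.1 w, y.2)

theorem absMul_absMul (u v : (𝓞 K)ˣ) (y : mixedSpace K) :
    absMul u (absMul v y) = absMul (u * v) y := by
  refine Prod.ext (funext fun w ↦ ?_) rfl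
  simp only [absMul, Units.val_mul]
  rw [show (((u : 𝓞 K) * v : 𝓞 K) : K) = (u : 𝓞 K) * (v : 𝓞 K) from rfl, map_mul, mul_assoc]

theorem absMul_one (y : mixedSpace K) : absMul 1 y = y := by
  refine Prod.ext (funext fun w ↦ ?_) rfl
  simp [absMul]

theorem absMul_sq [IsTotallyReal K] (v : (𝓞 K)ˣ) (y : mixedSpace K) :
    absMul (v ^ 2) y = mixedEmbedding K (((v : 𝓞 K) : K) ^ 2) * y := by
  refine Prod.ext (funext fun w ↦ ?_) (funext fun w ↦ ?_)
  · have h : (((v ^ 2 : (𝓞 K)ˣ) : 𝓞 K) : K) = ((v : 𝓞 K) : K) ^ 2 := rfl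
    simp only [absMul]
    rw [Prod.fst_mul, Pi.mul_apply, mixedEmbedding_apply_isReal, h, map_pow, map_pow,
      ← norm_embedding_of_isReal w.2, Real.norm_eq_abs, sq_abs]
  · exact absurd (IsTotallyReal.isReal w.1) (not_isReal_iff_isComplex.2 w.2)

theorem normAtPlace_absMul [IsTotallyReal K] (u : (𝓞 K)ˣ) (y : mixedSpace K) (w : InfinitePlace K) :
    normAtPlace w (absMul u y) = w ((u : 𝓞 K) : K) * normAtPlace w y := by
  rw [normAtPlace_apply_of_isReal (IsTotallyReal.isReal w),
    normAtPlace_apply_of_isReal (IsTotallyReal.isReal w), absMul, norm_mul, Real.norm_of_nonneg]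
  exact apply_nonneg w _

variable [NumberField K]

theorem prod_real_unit_eq_one [IsTotallyReal K] (u : (𝓞 K)ˣ) :
    ∏ w : {w : InfinitePlace K // IsReal w}, w.1 ((u : 𝓞 K) : K) = 1 := by
  have h := prod_eq_abs_norm ((u : 𝓞 K) : K)
  rw [Units.norm, Rat.cast_one] at h
  rw [← h, ← prod_infinitePlace_eq_prod_real]
  exact Finset.prod_congr rfl fun w _ ↦ by rw [IsTotallyReal.mult_eq, pow_one]

theorem measurePreserving_absMul [IsTotallyReal K] (u : (𝓞 K)ˣ) :
    MeasurePreserving (absMul u : mixedSpace K → mixedSpace K) := by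
  let D : {w : InfinitePlace K // IsReal w} → ℝ := fun w ↦ w.1 ((u : 𝓞 K) : K)
  have hdet : (Matrix.diagonal D).det = 1 := by
    rw [Matrix.det_diagonal]; exact prod_real_unit_eq_one u
  have h1 : MeasurePreserving (Matrix.toLin' (Matrix.diagonal D)) := by
    refine ⟨by fun_prop, ?_⟩
    have := Real.smul_map_diagonal_volume_pi (D := D) (by rw [hdet]; exact one_ne_zero)
    rwa [hdet, abs_one, ENNReal.ofReal_one, one_smul] at this
  have h2 : (absMul u : mixedSpace K → mixedSpace K) =
      Prod.map (Matrix.toLin' (Matrix.diagonal D)) id :=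
    funext fun y ↦ Prod.ext (funext fun w ↦ by simp [absMul, D, Matrix.mulVec_diagonal]) rfl
  rw [h2]
  exact h1.prod (MeasurePreserving.id _)

theorem norm_absMul [IsTotallyReal K] (u : (𝓞 K)ˣ) (y : mixedSpace K) :
    mixedEmbedding.norm (absMul u y) = mixedEmbedding.norm y := by
  rw [← norm_unit_smul u y]
  refine norm_eq_of_normAtPlace_eq fun w ↦ ?_
  rw [normAtPlace_absMul, unitSMul_smul, map_mul, normAtPlace_apply]

variable (K) in
/-- The product of powers of the fundamental units with prescribed exponents. -/
noncomputable def fundProd (m : Fin (Units.rank K) → ℤ) : (𝓞 K)ˣ :=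
  ∏ i, Units.fundSystem K i ^ m i

theorem fundProd_add (m m' : Fin (Units.rank K) → ℤ) :
    fundProd K (m + m') = fundProd K m * fundProd K m' := by
  simp [fundProd, zpow_add, Finset.prod_mul_distrib]

theorem fundProd_zero : fundProd K 0 = 1 := by simp [fundProd]

theorem eq_zero_of_fundProd_mem_torsion {m : Fin (Units.rank K) → ℤ}
    (h : fundProd K m ∈ Units.torsion K) : m = 0 := by
  have := (Units.exist_unique_eq_mul_prod K (fundProd K m)).unique
    (y₁ := (⟨_, h⟩, 0)) (y₂ := (1, m)) (by simp) (by simp [fundProd])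
  exact (congrArg Prod.snd this).symm

theorem exists_absMul_fundProd_mem [IsTotallyReal K] {y : mixedSpace K}
    (hy : mixedEmbedding.norm y ≠ 0) : ∃ m, absMul (fundProd K m) y ∈ fundamentalCone K := by
  obtain ⟨u, hu⟩ := fundamentalCone.exists_unit_smul_mem hy
  obtain ⟨⟨ζ, m⟩, h, -⟩ := Units.exist_unique_eq_mul_prod K u
  refine ⟨m, fundamentalCone.mem_of_normAtPlace_eq hu fun w ↦ ?_⟩
  have hζ := (Units.mem_torsion K).1 ζ.2 w
  have hu' : ((u : 𝓞 K) : K) = ((ζ : (𝓞 K)ˣ) : 𝓞 K) * ((fundProd K m : (𝓞 K)ˣ) : 𝓞 K) :=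
    congrArg (fun u : (𝓞 K)ˣ ↦ ((u : 𝓞 K) : K)) h
  rw [normAtPlace_absMul, unitSMul_smul, map_mul, normAtPlace_apply]
  exact congrArg (· * _) ((congrArg w hu').trans (by rw [map_mul, hζ, one_mul])).symm

variable (K) in
/-- The totally positive part of the fundamental cone cut off at norm `B`. -/
def posCone (B : ℝ) : Set (mixedSpace K) :=
  plusPart (fundamentalCone K ∩ {y | mixedEmbedding.norm y ≤ B})

theorem measurableSet_posCone (B : ℝ) : MeasurableSet (posCone K B) :=
  measurableSet_plusPart ((measurableSet_fundamentalCone K).inter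
    (measurableSet_le (mixedEmbedding.continuous_norm K).measurable measurable_const))

theorem volume_posCone_one [IsTotallyReal K] :
    volume (posCone K 1) = ENNReal.ofReal (Units.regulator K) := by
  have h := volume_eq_two_pow_mul_volume_plusPart (A := fundamentalCone.normLeOne K) (fun x ↦ by
    have hx : ∀ w, normAtPlace w ((fun w ↦ ‖x.1 w‖, x.2) : mixedSpace K) = normAtPlace w x := by
      intro w
      rw [normAtPlace_apply_of_isReal (IsTotallyReal.isReal w),
        normAtPlace_apply_of_isReal (IsTotallyReal.isReal w), norm_norm]
    rw [fundamentalCone.mem_normLeOne, fundamentalCone.mem_normLeOne, norm_eq_of_normAtPlace_eq hx]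
    exact and_congr_left' ⟨fun h ↦ fundamentalCone.mem_of_normAtPlace_eq h hx,
      fun h ↦ fundamentalCone.mem_of_normAtPlace_eq h fun w ↦ (hx w).symm⟩)
    (fundamentalCone.measurableSet_normLeOne K)
  rw [fundamentalCone.volume_normLeOne, IsTotallyReal.nrComplexPlaces_eq_zero, pow_zero,
    mul_one] at h
  exact ((ENNReal.mul_right_inj (by simp) (by simp)).1 h).symm

theorem volume_posCone [IsTotallyReal K] {B : ℝ} (hB : 0 < B) :
    volume (posCone K B) = ENNReal.ofReal (B * Units.regulator K) := by
  have hn : (finrank ℚ K : ℝ) ≠ 0 := by exact_mod_cast finrank_pos.ne'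
  let c : ℝ := B ^ ((finrank ℚ K : ℝ)⁻¹)
  have hc : 0 < c := Real.rpow_pos_of_pos hB _
  have hcn : c ^ finrank ℚ K = B := by
    rw [← Real.rpow_natCast, ← Real.rpow_mul hB.le, inv_mul_cancel₀ hn, Real.rpow_one]
  have h : posCone K B = (fun y ↦ c⁻¹ • y) ⁻¹' posCone K 1 := by
    ext y
    simp only [posCone, Set.mem_inter_iff, Set.mem_ofPred_eq, Set.mem_preimage,
      fundamentalCone.smul_mem_iff_mem (inv_ne_zero hc.ne'), mixedEmbedding.norm_smul,
      abs_of_pos (inv_pos.2 hc), inv_pow, hcn, Prod.smul_fst, Pi.smul_apply, smul_eq_mul,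
      inv_mul_le_iff₀ hB, mul_one, mul_pos_iff_of_pos_left (inv_pos.2 hc)]
  rw [h, Measure.addHaar_preimage_smul _ (inv_ne_zero hc.ne'), volume_posCone_one,
    mixedEmbedding.finrank, inv_pow, inv_inv, hcn, abs_of_pos hB, ENNReal.ofReal_mul hB.le]

theorem mem_torsion_of_rat_mul_sq_eq_one [IsTotallyReal K] {v : (𝓞 K)ˣ} {q : ℚ} (hq : 0 < q)
    (h : (q : K) * ((v : 𝓞 K) : K) ^ 2 = 1) : v ∈ Units.torsion K := by
  have hw : ∀ w w' : InfinitePlace K, w ((v : 𝓞 K) : K) = w' ((v : 𝓞 K) : K) := by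
    have h1 : ∀ w : InfinitePlace K, (q : ℝ) * w ((v : 𝓞 K) : K) ^ 2 = 1 := fun w ↦ by
      have := congrArg w h
      rw [map_mul, map_pow, map_one, ← norm_embedding_eq, map_ratCast, Complex.norm_ratCast,
        abs_of_pos (by exact_mod_cast hq)] at this
      exact this
    intro w w'
    have hq' : (q : ℝ) ≠ 0 := by exact_mod_cast hq.ne'
    exact (pow_left_inj₀ (apply_nonneg w _) (apply_nonneg w' _) two_ne_zero).1
      (mul_left_cancel₀ hq' ((h1 w).trans (h1 w').symm))
  refine (Units.mem_torsion K).2 fun w ↦ ?_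
  have h2 := prod_real_unit_eq_one v
  rw [Finset.prod_congr rfl fun w' _ ↦ hw w'.1 w, Finset.prod_const, Finset.card_univ,
    card_real_eq_finrank] at h2
  exact (pow_eq_one_iff_of_nonneg (apply_nonneg w _) finrank_pos.ne').1 h2

theorem IsMinVecCombination.eq_of_absMul_fundProd [IsTotallyReal K] {J : Type*} {a : J → K}
    (ha : ∀ j, IsPerfectForm (a j)) (hinj : ∀ j j', Homothetic (a j) (a j') → j = j') {j j' : J}
    {k k' e : Fin (Units.rank K) → ℤ} {y y' : mixedSpace K} (hy : IsMinVecCombination (a j) y)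
    (hy' : IsMinVecCombination (a j') y')
    (h : absMul (fundProd K (e + (k + k))) y = absMul (fundProd K (e + (k' + k'))) y') :
    j = j' ∧ k = k' := by
  have hyy : y' = mixedEmbedding K (((fundProd K (k - k') : 𝓞 K) : K) ^ 2) * y := by
    have := congrArg (absMul (fundProd K (-(e + (k' + k'))))) h
    rw [absMul_absMul, absMul_absMul, ← fundProd_add, ← fundProd_add, neg_add_cancel, fundProd_zero,
      absMul_one] at this
    rw [← this, ← absMul_sq, sq, ← fundProd_add]
    congr 2
    abel
  rw [hyy] at hy'
  obtain ⟨q, hq, haq⟩ := (ha j).exists_rat_eq_mul_sq (ha j') hy hy'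
  obtain rfl : j' = j := hinj _ _ ⟨q, hq, _, haq⟩
  refine ⟨rfl, sub_eq_zero.1 (eq_zero_of_fundProd_mem_torsion
    (mem_torsion_of_rat_mul_sq_eq_one hq ?_))⟩
  have ha0 : a j' ≠ 0 := fun h0 ↦ by
    have := (ha j').1 (embedding_of_isReal
      (IsTotallyReal.isReal (Classical.arbitrary (InfinitePlace K))))
    simp [h0] at this
  refine mul_left_cancel₀ ha0 ?_
  linear_combination -haq

theorem exists_fin_two_add_self {ι : Type*} (m : ι → ℤ) :
    ∃ (e : ι → Fin 2) (k : ι → ℤ), m = (fun i ↦ ((e i : ℕ) : ℤ)) + (k + k) := by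
  have h : ∀ i, ∃ (e : Fin 2) (k : ℤ), m i = (e : ℕ) + (k + k) := fun i ↦ by
    rcases Int.even_or_odd' (m i) with ⟨k, hk | hk⟩
    · exact ⟨0, k, by simp; lia⟩
    · exact ⟨1, k, by simp; lia⟩
  choose e k h using h
  exact ⟨e, k, funext h⟩

theorem card_mul_sqrt_discr_le [IsTotallyReal K] {J : Type*} [Fintype J] {a : J → K}
    (ha : ∀ j, IsPerfectForm (a j)) (hinj : ∀ j j', Homothetic (a j) (a j') → j = j') :
    Fintype.card J * √|(discr K : ℝ)| ≤ 2 ^ Units.rank K *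
      ((finrank ℚ K : ℝ) ^ finrank ℚ K * |(discr K : ℝ)| * Units.regulator K) := by
  choose D hD hvol hcomb using fun j ↦ (ha j).exists_measurableSet
  set B := (finrank ℚ K : ℝ) ^ finrank ℚ K * |(discr K : ℝ)| with hBdef
  have hB : 0 < B := by
    have h1 : (0 : ℝ) < finrank ℚ K := by exact_mod_cast finrank_pos
    have h2 : (discr K : ℝ) ≠ 0 := by exact_mod_cast discr_ne_zero K
    positivity
  let u : (Fin (Units.rank K) → Fin 2) → (Fin (Units.rank K) → ℤ) → (𝓞 K)ˣ :=
    fun e k ↦ fundProd K ((fun i ↦ ((e i : ℕ) : ℤ)) + (k + k))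
  let P : (Fin (Units.rank K) → Fin 2) → J → (Fin (Units.rank K) → ℤ) → Set (mixedSpace K) :=
    fun e j k ↦ D j ∩ absMul (u e k) ⁻¹' posCone K B
  have hPm : ∀ e j k, MeasurableSet (P e j k) := fun e j k ↦
    (hD j).inter ((measurePreserving_absMul _).measurable (measurableSet_posCone B))
  have hcover : ∀ j, D j ⊆ ⋃ p : (Fin (Units.rank K) → Fin 2) × (Fin (Units.rank K) → ℤ),
      P p.1 j p.2 := fun j y hy ↦ by
    have hpos := fun w ↦ (hcomb j y hy).pos (ha j) w
    have hnorm : mixedEmbedding.norm y ≠ 0 := by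
      rw [norm_eq_prod_abs]
      exact Finset.prod_ne_zero_iff.2 fun w _ ↦ abs_ne_zero.2 (hpos w).ne'
    obtain ⟨m, hm⟩ := exists_absMul_fundProd_mem hnorm
    obtain ⟨e, k, rfl⟩ := exists_fin_two_add_self m
    refine Set.mem_iUnion.2 ⟨(e, k), hy, ⟨hm, ?_⟩, fun w ↦ mul_pos ?_ (hpos w)⟩
    · rw [Set.mem_ofPred_eq, norm_absMul]
      exact (hcomb j y hy).norm_le (ha j)
    · rw [InfinitePlace.pos_iff]
      exact RingOfIntegers.coe_ne_zero_iff.2 (Units.ne_zero _)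
  have hle : ∀ j, ENNReal.ofReal (√|(discr K : ℝ)|) ≤ ∑ e, ∑' k, volume (P e j k) := fun j ↦ by
    refine (hvol j).trans ((measure_mono (hcover j)).trans ((measure_iUnion_le _).trans ?_))
    rw [ENNReal.tsum_prod', tsum_fintype]
  have hsum : ∀ e, ∑ j, ∑' k, volume (P e j k) ≤
      ENNReal.ofReal (B * Units.regulator K) := fun e ↦ by
    let Q : J × (Fin (Units.rank K) → ℤ) → Set (mixedSpace K) :=
      fun p ↦ absMul (u e p.2)⁻¹ ⁻¹' P e p.1 p.2
    have hQ : ∀ p, volume (Q p) = volume (P e p.1 p.2) := fun p ↦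
      (measurePreserving_absMul _).measure_preimage (hPm ..).nullMeasurableSet
    have hcancel : ∀ k z, absMul (u e k) (absMul (u e k)⁻¹ z) = z := fun k z ↦ by
      rw [absMul_absMul, mul_inv_cancel, absMul_one]
    have hdisj : Pairwise (Function.onFun Disjoint Q) := fun p p' hne ↦ by
      refine Set.disjoint_left.2 fun z hz hz' ↦ hne ?_
      obtain ⟨h1, h2⟩ := IsMinVecCombination.eq_of_absMul_fundProd ha hinj (hcomb _ _ hz.1)
        (hcomb _ _ hz'.1) ((hcancel p.2 z).trans (hcancel p'.2 z).symm)
      exact Prod.ext h1 h2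
    calc ∑ j, ∑' k, volume (P e j k) = ∑' p, volume (Q p) := by
          rw [ENNReal.tsum_prod', tsum_fintype]
          simp only [hQ]
      _ = volume (⋃ p, Q p) := (measure_iUnion hdisj fun p ↦
          (measurePreserving_absMul _).measurable (hPm ..)).symm
      _ ≤ volume (posCone K B) := measure_mono <| Set.iUnion_subset fun p z hz ↦ by
          rw [← hcancel p.2 z]
          exact hz.2
      _ = _ := volume_posCone hB
  have hfin : (Fintype.card J : ENNReal) * ENNReal.ofReal (√|(discr K : ℝ)|) ≤
      2 ^ Units.rank K * ENNReal.ofReal (B * Units.regulator K) :=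
    calc (Fintype.card J : ENNReal) * ENNReal.ofReal (√|(discr K : ℝ)|)
        = ∑ _j : J, ENNReal.ofReal (√|(discr K : ℝ)|) := by simp
      _ ≤ ∑ j, ∑ e, ∑' k, volume (P e j k) := Finset.sum_le_sum fun j _ ↦ hle j
      _ = ∑ e, ∑ j, ∑' k, volume (P e j k) := Finset.sum_comm
      _ ≤ ∑ _e : Fin (Units.rank K) → Fin 2, ENNReal.ofReal (B * Units.regulator K) :=
          Finset.sum_le_sum fun e _ ↦ hsum e
      _ = _ := by simp
  have hR := Units.regulator_pos K
  rw [← ENNReal.ofReal_natCast, ← ENNReal.ofReal_mul (by positivity), ← ENNReal.ofReal_ofNat,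
    ← ENNReal.ofReal_pow (by positivity), ← ENNReal.ofReal_mul (by positivity),
    ENNReal.ofReal_le_ofReal_iff (by positivity)] at hfin
  exact hfin

theorem numClasses_mul_sqrt_discr_le [IsTotallyReal K] :
    numClasses K * √|(discr K : ℝ)| ≤ 2 ^ Units.rank K *
      ((finrank ℚ K : ℝ) ^ finrank ℚ K * |(discr K : ℝ)| * Units.regulator K) := by
  have hR := Units.regulator_pos K
  rw [numClasses]
  rcases finite_or_infinite
    (Quot fun a b : {a : K // IsPerfectForm a} ↦ Homothetic (a : K) (b : K)) with h | h
  · have := Fintype.ofFinite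
      (Quot fun a b : {a : K // IsPerfectForm a} ↦ Homothetic (a : K) (b : K))
    rw [Nat.card_eq_fintype_card]
    refine card_mul_sqrt_discr_le (a := fun j ↦ (j.out : K)) (fun j ↦ j.out.2) fun j j' hj ↦ ?_
    rw [← Quot.out_eq j, ← Quot.out_eq j']
    exact Quot.sound hj
  · rw [Nat.card_eq_zero_of_infinite, Nat.cast_zero, zero_mul]
    positivity

end

section

open InfinitePlace mixedEmbedding Module MeasureTheory

theorem two_pow_mul_factorial_le {n : ℕ} (hn2 : 2 ≤ n) (hn11 : n ≤ 11) :
    (2 : ℝ) ^ (n - 1) * n.factorial ≤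
      (Real.exp 1 * √((n : ℝ) - 1) / 2) ^ n * (2 / π) ^ (2 * n) * Gamma (2 + (n : ℝ) / 2) ^ 4 := by
  have hc : 11 / 20 ≤ Real.exp 1 / 2 * (2 / π) ^ 2 := by
    have h1 := Real.exp_one_gt_d9
    have h2 := Real.pi_lt_d4
    have h3 := Real.pi_pos
    rw [div_pow, div_mul_div_comm, le_div_iff₀ (by positivity)]
    nlinarith
  have hstep : ∀ {x y : ℝ}, 0 < x → y ≤ Gamma x → x * y ≤ Gamma (x + 1) := fun {x y} hx h ↦ by
    rw [Gamma_add_one hx.ne']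
    gcongr
  have h5 : 132 / 100 ≤ Gamma (5 / 2) := by
    have h : 88 / 50 ≤ √π := Real.le_sqrt_of_sq_le (by have := Real.pi_gt_d2; norm_num; linarith)
    rw [show (5 / 2 : ℝ) = 1 / 2 + 1 + 1 by norm_num, Gamma_add_one (by norm_num),
      Gamma_add_one (by norm_num), Gamma_one_half_eq]
    linarith
  have key : ∀ {s g x : ℝ}, g ≤ Gamma x → x = 2 + (n : ℝ) / 2 → 0 ≤ s → 0 ≤ g →
      s ^ 2 ≤ (n : ℝ) - 1 → (2 : ℝ) ^ (n - 1) * n.factorial ≤ (11 / 20 * s) ^ n * g ^ 4 →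
      (2 : ℝ) ^ (n - 1) * n.factorial ≤ (Real.exp 1 * √((n : ℝ) - 1) / 2) ^ n *
        (2 / π) ^ (2 * n) * Gamma (2 + (n : ℝ) / 2) ^ 4 := fun {s g x} h2 hx hs hg h1 h3 ↦ by
    subst hx
    refine h3.trans ?_
    rw [pow_mul, ← mul_pow]
    have h4 : s ≤ √((n : ℝ) - 1) := Real.le_sqrt_of_sq_le h1
    have h5 : 11 / 20 * s ≤ Real.exp 1 * √((n : ℝ) - 1) / 2 * (2 / π) ^ 2 := by
      calc 11 / 20 * s ≤ (Real.exp 1 / 2 * (2 / π) ^ 2) * √((n : ℝ) - 1) := by gcongr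
        _ = _ := by ring
    gcongr
  have h7 := hstep (by norm_num) h5
  have h9 := hstep (by norm_num) h7
  have h11 := hstep (by norm_num) h9
  have h13 := hstep (by norm_num) h11
  have h15 := hstep (by norm_num) h13
  have hfac := fun m ↦ (Gamma_nat_eq_factorial m).ge
  interval_cases n
  · exact key (s := 1) (hfac 2) (by norm_num) (by norm_num) (by positivity) (by norm_num)
      (by norm_num [Nat.factorial])
  · exact key (s := 7 / 5) h7 (by norm_num) (by norm_num) (by positivity) (by norm_num)
      (by norm_num [Nat.factorial])
  · exact key (s := 17 / 10) (hfac 3) (by norm_num) (by norm_num) (by positivity) (by norm_num)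
      (by norm_num [Nat.factorial])
  · exact key (s := 2) h9 (by norm_num) (by norm_num) (by positivity) (by norm_num)
      (by norm_num [Nat.factorial])
  · exact key (s := 11 / 5) (hfac 4) (by norm_num) (by norm_num) (by positivity) (by norm_num)
      (by norm_num [Nat.factorial])
  · exact key (s := 12 / 5) h11 (by norm_num) (by norm_num) (by positivity) (by norm_num)
      (by norm_num [Nat.factorial])
  · exact key (s := 13 / 5) (hfac 5) (by norm_num) (by norm_num) (by positivity) (by norm_num)
      (by norm_num [Nat.factorial])
  · exact key (s := 14 / 5) h13 (by norm_num) (by norm_num) (by positivity) (by norm_num)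
      (by norm_num [Nat.factorial])
  · exact key (s := 3) (hfac 6) (by norm_num) (by norm_num) (by positivity) (by norm_num)
      (by norm_num [Nat.factorial])
  · exact key (s := 31 / 10) h15 (by norm_num) (by norm_num) (by positivity) (by norm_num)
      (by norm_num [Nat.factorial])

variable {K : Type*} [Field K] [NumberField K]

theorem units_rank_eq [IsTotallyReal K] : Units.rank K = finrank ℚ K - 1 := by
  rw [Units.rank, card_eq_nrRealPlaces_add_nrComplexPlaces,
    IsTotallyReal.nrComplexPlaces_eq_zero K, IsTotallyReal.finrank K, add_zero]

theorem finrank_pow_le_factorial_mul_sqrt_discr [IsTotallyReal K] :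
    (finrank ℚ K : ℝ) ^ finrank ℚ K ≤ (finrank ℚ K).factorial * √|(discr K : ℝ)| := by
  have h := abs_discr_ge' K
  rw [IsTotallyReal.nrComplexPlaces_eq_zero K, mul_zero, pow_zero, one_mul, mul_comm 2, pow_mul,
    ← div_pow] at h
  push_cast at h
  have h1 := Real.le_sqrt_of_sq_le h
  rwa [div_le_iff₀' (by positivity)] at h1

theorem numClasses_le [IsTotallyReal K] : (numClasses K : ℝ) ≤
    2 ^ (finrank ℚ K - 1) * (finrank ℚ K).factorial * |(discr K : ℝ)| * Units.regulator K := by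
  have hΔ : 0 < |(discr K : ℝ)| := abs_pos.mpr (by exact_mod_cast discr_ne_zero K)
  have h := numClasses_mul_sqrt_discr_le (K := K)
  rw [units_rank_eq] at h
  have hR := Units.regulator_pos K
  refine le_of_mul_le_mul_right (h.trans ?_) (Real.sqrt_pos.mpr hΔ)
  calc _ ≤ 2 ^ (finrank ℚ K - 1) * ((finrank ℚ K).factorial * √|(discr K : ℝ)| *
        |(discr K : ℝ)| * Units.regulator K) := by
        gcongr
        exact finrank_pow_le_factorial_mul_sqrt_discr
    _ = _ := by ring

theorem exp_one_mul_pow_mul_le_exp {n : ℕ} (hn : n ≠ 0) {c R ρ : ℝ} (hc : 0 ≤ c) (hR : 0 ≤ R)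
    (hρ : 0 ≤ ρ) :
    (Real.exp 1 * c) ^ n * R ≤ Real.exp (n * √((c * R ^ ((1 : ℝ) / n)) ^ 2 + ρ)) := by
  set η := c * R ^ ((1 : ℝ) / n) with hη
  have hη0 : 0 ≤ η := by positivity
  calc (Real.exp 1 * c) ^ n * R = (Real.exp 1 * η) ^ n := by
        rw [hη, ← mul_assoc, mul_pow _ (R ^ _), one_div, Real.rpow_inv_natCast_pow hR hn]
    _ ≤ (Real.exp η) ^ n := by
        gcongr
        have h := Real.add_one_le_exp (η - 1)
        rw [sub_add_cancel] at h
        calc Real.exp 1 * η ≤ Real.exp 1 * Real.exp (η - 1) := by gcongr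
          _ = Real.exp η := by rw [← Real.exp_add]; ring_nf
    _ = Real.exp (n * η) := by rw [← Real.exp_nat_mul]
    _ ≤ _ := by
        gcongr
        exact Real.le_sqrt_of_sq_le (by linarith)

end

/-- Unconditional bound on the number of homothety classes of perfect
unary forms for a totally real field of degree `2 ≤ n ≤ 11`. -/
theorem perfect_form_classes_bound_small_degree_unconditional
    (K : Type*) [Field K] [NumberField K] (n : ℕ)
    (hdeg : Module.finrank ℚ K = n) (hn2 : 2 ≤ n) (hn11 : n ≤ 11)
    (htr : TotallyReal K) :
    (numClasses K : ℝ) ≤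
      Real.exp ((n : ℝ) * Real.sqrt
          ((Real.sqrt ((n : ℝ) - 1) / 2 *
              NumberField.Units.regulator K ^ ((1 : ℝ) / (n : ℝ))) ^ 2 +
            4 / ((n : ℝ) - 1) *
              Real.log ((n : ℝ) ^ (-(n : ℝ) / 2) *
                  Real.sqrt |(NumberField.discr K : ℝ)| * (2 / π) ^ ((n : ℝ) / 2) *
                  Real.Gamma (2 + (n : ℝ) / 2)) ^ 2)) *
        |(NumberField.discr K : ℝ)| * (2 / π) ^ (2 * n) *
        Real.Gamma (2 + (n : ℝ) / 2) ^ 4 := by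
  have : IsTotallyReal K := ⟨htr⟩
  have h1 := numClasses_le (K := K)
  rw [hdeg] at h1
  have hR := Units.regulator_pos K
  have hn : (0 : ℝ) < (n : ℝ) - 1 := by
    have : (2 : ℝ) ≤ n := by exact_mod_cast hn2
    linarith
  have h2 := two_pow_mul_factorial_le hn2 hn11
  rw [mul_div_assoc] at h2
  refine h1.trans ?_
  calc _ ≤ (Real.exp 1 * (√((n : ℝ) - 1) / 2)) ^ n * (2 / π) ^ (2 * n) *
        Gamma (2 + (n : ℝ) / 2) ^ 4 * |(discr K : ℝ)| * Units.regulator K := by gcongr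
    _ = ((Real.exp 1 * (√((n : ℝ) - 1) / 2)) ^ n * Units.regulator K) *
        |(discr K : ℝ)| * (2 / π) ^ (2 * n) * Gamma (2 + (n : ℝ) / 2) ^ 4 := by ring
    _ ≤ _ := by
        gcongr
        exact exp_one_mul_pow_mul_le_exp (by lia) (by positivity) hR.le (by positivity)
end

section
/- Let K be a totally real number field of degree n over ℚ with discriminant Δ_K. Then for every totally positive a ∈ K and every x ∈ M(a), |Nm_{K/ℚ}(x)| ≤ n^{-n/2} · √|Δ_K| · (2/π)^{n/2} · Γ(2 + n/2). In particular, every totally real number field K is A-reducible with A = n^{-n/2} · √|Δ_K| · (2/π)^{n/2} · Γ(2 + n/2). -/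
open NumberField Real

open MeasureTheory

section Blichfeldt

variable {E : Type*} [NormedAddCommGroup E] [InnerProductSpace ℝ E]

lemma sum_sum_norm_sub_sq {ι : Type*} (s : Finset ι) (x : ι → E) :
    ∑ i ∈ s, ∑ j ∈ s, ‖x i - x j‖ ^ 2 =
      2 * s.card * ∑ i ∈ s, ‖x i‖ ^ 2 - 2 * ‖∑ i ∈ s, x i‖ ^ 2 := by
  simp_rw [norm_sub_sq_real, Finset.sum_add_distrib, Finset.sum_sub_distrib, ← Finset.mul_sum,
    ← inner_sum, ← sum_inner, real_inner_self_eq_norm_sq, Finset.sum_const, nsmul_eq_mul,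
    ← Finset.mul_sum]
  ring

/-- Blichfeldt's inequality. -/
lemma sum_one_sub_norm_sq_le_one {ι : Type*} (s : Finset ι) (x : ι → E)
    (hx : ∀ i ∈ s, ∀ j ∈ s, i ≠ j → 2 ≤ ‖x i - x j‖ ^ 2) :
    ∑ i ∈ s, (1 - ‖x i‖ ^ 2) ≤ 1 := by
  classical
  rcases s.eq_empty_or_nonempty with rfl | hs
  · simp
  have hcard : (0 : ℝ) < s.card := by exact_mod_cast hs.card_pos
  have lower : ∑ i ∈ s, ∑ j ∈ s, (if i = j then (0 : ℝ) else 2) ≤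
      ∑ i ∈ s, ∑ j ∈ s, ‖x i - x j‖ ^ 2 := by
    refine Finset.sum_le_sum fun i hi => Finset.sum_le_sum fun j hj => ?_
    split_ifs with h
    · positivity
    · exact hx i hi j hj h
  have count : ∑ i ∈ s, ∑ j ∈ s, (if i = j then (0 : ℝ) else 2) =
      2 * s.card * (s.card - 1) := by
    have h : ∀ i j : ι, (if i = j then (0 : ℝ) else 2) = 2 - if i = j then 2 else 0 := by
      intro i j
      split_ifs <;> norm_num
    simp only [h, Finset.sum_sub_distrib, Finset.sum_ite_eq, Finset.sum_const, nsmul_eq_mul,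
      Finset.sum_ite_mem, Finset.inter_self]
    ring
  rw [count, sum_sum_norm_sub_sq] at lower
  have h : 2 * (s.card : ℝ) * (s.card - 1) ≤ 2 * s.card * ∑ i ∈ s, ‖x i‖ ^ 2 := by
    nlinarith [sq_nonneg ‖∑ i ∈ s, x i‖]
  have := le_of_mul_le_mul_left h (by positivity)
  rw [Finset.sum_sub_distrib, Finset.sum_const, nsmul_eq_mul]
  linarith

lemma tsum_ofReal_one_sub_norm_sq_le_one {ι : Type*} (x : ι → E)
    (hx : ∀ i j, i ≠ j → 2 ≤ ‖x i - x j‖ ^ 2) :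
    ∑' i, ENNReal.ofReal (1 - ‖x i‖ ^ 2) ≤ 1 := by
  classical
  rw [ENNReal.tsum_eq_iSup_sum]
  refine iSup_le fun s => ?_
  rw [← Finset.sum_filter_of_ne (p := fun i => 0 ≤ 1 - ‖x i‖ ^ 2)
    fun i _ hi => (ENNReal.ofReal_pos.mp (pos_iff_ne_zero.mpr hi)).le,
    ← ENNReal.ofReal_sum_of_nonneg fun i hi => (Finset.mem_filter.mp hi).2]
  exact ENNReal.ofReal_le_one.mpr (sum_one_sub_norm_sq_le_one _ x fun i _ j _ => hx i j)

lemma lintegral_ofReal_one_sub_norm_sq_le_measure {V : Type*} [AddCommGroup V]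
    [MeasurableSpace V] [MeasurableAdd V] (L : Submodule ℤ V) [Countable L] {F : Set V}
    {μ : Measure V} [μ.IsAddLeftInvariant] (hF : IsAddFundamentalDomain L F μ) (T : V →+ E)
    (hT : Measurable fun v => ENNReal.ofReal (1 - ‖T v‖ ^ 2))
    (hL : ∀ v ∈ L, v ≠ 0 → 2 ≤ ‖T v‖ ^ 2) :
    ∫⁻ v, ENNReal.ofReal (1 - ‖T v‖ ^ 2) ∂μ ≤ μ F := by
  have : VAddInvariantMeasure L V μ := inferInstanceAs (VAddInvariantMeasure L.toAddSubgroup V μ)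
  have : MeasurableConstVAdd L V := inferInstanceAs (MeasurableConstVAdd L.toAddSubgroup V)
  have hmeas : ∀ g : L, AEMeasurable (fun v : V => ENNReal.ofReal ((1 : ℝ) - ‖T (-g +ᵥ v)‖ ^ 2))
      (μ.restrict F) := fun g => (hT.comp (measurable_const_vadd (-g))).aemeasurable
  rw [hF.lintegral_eq_tsum', ← lintegral_tsum hmeas]
  calc _ ≤ ∫⁻ _ in F, 1 ∂μ := by
        refine lintegral_mono fun v => ?_
        refine tsum_ofReal_one_sub_norm_sq_le_one (fun g : L => T (-g +ᵥ v)) fun i j hij => ?_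
        have h : T (-i +ᵥ v) - T (-j +ᵥ v) = T ((j - i : L) : V) := by
          rw [← map_sub]
          congr 1
          simp only [Submodule.vadd_def, vadd_eq_add, Submodule.coe_neg, Submodule.coe_sub]
          abel
        rw [h]
        refine hL _ (j - i).2 fun h0 => hij ?_
        exact (sub_eq_zero.mp (Subtype.ext h0)).symm
    _ = μ F := by simp

end Blichfeldt

lemma EuclideanSpace.lintegral_ofReal_one_sub_norm_sq (ι : Type*) [Fintype ι] [Nonempty ι] :
    ∫⁻ y : EuclideanSpace ℝ ι, ENNReal.ofReal (1 - ‖y‖ ^ 2) =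
      ENNReal.ofReal (π ^ ((Fintype.card ι : ℝ) / 2) / Gamma (2 + (Fintype.card ι : ℝ) / 2)) := by
  generalize hn : Fintype.card ι = n
  have hn0 : 0 < n := hn ▸ Fintype.card_pos
  have hint : Integrable fun y : EuclideanSpace ℝ ι => max (1 - ‖y‖ ^ 2) 0 := by
    refine Continuous.integrable_of_hasCompactSupport (by fun_prop) ?_
    refine HasCompactSupport.intro (isCompact_closedBall 0 1) fun y hy => ?_
    rw [mem_closedBall_zero_iff, not_le] at hy
    exact max_eq_right (by nlinarith)
  have hpolar : ∫ r in Set.Ioi (0 : ℝ), r ^ (n - 1) • max (1 - r ^ 2) 0 =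
      1 / (n : ℝ) - 1 / (n + 2) := by
    rw [setIntegral_eq_of_subset_of_forall_sdiff_eq_zero (s := Set.Ioc 0 1) measurableSet_Ioi
      Set.Ioc_subset_Ioi_self ?_, ← intervalIntegral.integral_of_le zero_le_one]
    · have : ∫ r in (0 : ℝ)..1, r ^ (n - 1) • max (1 - r ^ 2) 0 =
          ∫ r in (0 : ℝ)..1, (r ^ (n - 1) - r ^ (n + 1)) := by
        refine intervalIntegral.integral_congr fun r hr => ?_
        rw [Set.uIcc_of_le zero_le_one] at hr
        have h2 : n + 1 = (n - 1) + 2 := by omega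
        simp only [smul_eq_mul]
        rw [max_eq_left (by nlinarith [hr.1, hr.2]), h2, pow_add]
        ring
      rw [this, intervalIntegral.integral_sub ((continuous_pow _).intervalIntegrable _ _)
        ((continuous_pow _).intervalIntegrable _ _), integral_pow, integral_pow]
      have h3 : ((n - 1 : ℕ) : ℝ) + 1 = n := by
        rw [Nat.cast_sub hn0]; simp
      rw [h3]
      have : n - 1 + 1 = n := by omega
      push_cast
      simp [hn0.ne', add_assoc]
      norm_num
    · intro r hr
      have h1 : 1 < r := by
        by_contra! h
        exact hr.2 ⟨hr.1, h⟩
      rw [max_eq_right (by nlinarith), smul_zero]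
  have hmax : ∀ y : EuclideanSpace ℝ ι,
      ENNReal.ofReal (1 - ‖y‖ ^ 2) = ENNReal.ofReal (max (1 - ‖y‖ ^ 2) 0) := by
    intro y
    rw [ENNReal.ofReal_max, ENNReal.ofReal_zero, max_eq_left zero_le]
  simp_rw [hmax]
  rw [← ofReal_integral_eq_lintegral_ofReal hint (.of_forall fun _ => le_max_right _ _),
    integral_fun_norm_addHaar volume fun r : ℝ => max (1 - r ^ 2) 0, finrank_euclideanSpace,
    hn, hpolar, measureReal_def, EuclideanSpace.volume_ball, hn]
  congr 1
  have hG : Gamma (2 + (n : ℝ) / 2) = ((n : ℝ) / 2 + 1) * Gamma ((n : ℝ) / 2 + 1) := by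
    rw [← Gamma_add_one (by positivity)]
    ring_nf
  have hGpos : 0 < Gamma ((n : ℝ) / 2 + 1) := Gamma_pos_of_pos (by positivity)
  have hpi : √π ^ n = π ^ ((n : ℝ) / 2) := by
    rw [sqrt_eq_rpow, ← rpow_natCast, ← rpow_mul pi_pos.le]
    ring_nf
  have hn' : (n : ℝ) ≠ 0 := by positivity
  rw [ENNReal.ofReal_one, one_pow, one_mul, ENNReal.toReal_ofReal (by positivity), hG, hpi]
  simp only [smul_eq_mul, nsmul_eq_mul]
  field_simp
  ring

lemma lintegral_ofReal_one_sub_sum_sq {ι : Type*} [Fintype ι] [Nonempty ι] (d : ι → ℝ)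
    (hd : ∀ i, 0 < d i) :
    ∫⁻ y : ι → ℝ, ENNReal.ofReal (1 - ‖WithLp.toLp 2 fun i => d i * y i‖ ^ 2) =
      ENNReal.ofReal (∏ i, d i)⁻¹ *
      ENNReal.ofReal (π ^ ((Fintype.card ι : ℝ) / 2) / Gamma (2 + (Fintype.card ι : ℝ) / 2)) := by
  classical
  have hpos : 0 < ∏ i, d i := Finset.prod_pos fun i _ => hd i
  have hdet : (Matrix.diagonal d).det ≠ 0 := by rw [Matrix.det_diagonal]; exact hpos.ne'
  rw [← EuclideanSpace.lintegral_ofReal_one_sub_norm_sq,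
    ← (PiLp.volume_preserving_toLp ι).lintegral_comp (by fun_prop)]
  conv_rhs => rw [← Real.smul_map_diagonal_volume_pi hdet]
  rw [lintegral_smul_measure, lintegral_map (by fun_prop)
    (LinearMap.continuous_on_pi _).measurable, Matrix.det_diagonal, abs_of_pos hpos, smul_eq_mul,
    ← mul_assoc, ← ENNReal.ofReal_mul (by positivity), inv_mul_cancel₀ hpos.ne',
    ENNReal.ofReal_one, one_mul]
  refine lintegral_congr fun y => ?_
  congr 4
  ext i
  simp [Matrix.mulVec_diagonal]

lemma abs_prod_le_rpow_sum_sq_div_card {ι : Type*} [Fintype ι] [Nonempty ι] (z : ι → ℝ) :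
    |∏ i, z i| ≤ ((∑ i, z i ^ 2) / Fintype.card ι) ^ ((Fintype.card ι : ℝ) / 2) := by
  have hn : (0 : ℝ) < Fintype.card ι := by exact_mod_cast Fintype.card_pos
  have h := geom_mean_le_arith_mean Finset.univ (fun _ : ι => 1) (fun i => z i ^ 2)
    (fun _ _ => zero_le_one) (by simpa using hn) (fun i _ => sq_nonneg (z i))
  simp only [rpow_one, Finset.sum_const, Finset.card_univ, nsmul_eq_mul, mul_one, one_mul,
    Finset.prod_pow] at h
  refine le_trans (le_of_eq ?_) (rpow_le_rpow (by positivity) h (by positivity))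
  rw [← rpow_mul (sq_nonneg _), ← sqrt_sq_eq_abs, sqrt_eq_rpow]
  congr 1
  field_simp

namespace NumberField

open InfinitePlace mixedEmbedding

variable {K : Type*} [Field K] [NumberField K]

/-- For a totally real field, the real places correspond to the complex embeddings. -/
lemma bijective_equivRatAlgHom_embedding_real_place (htr : TotallyReal K) :
    Function.Bijective fun w : {w : InfinitePlace K // w.IsReal} =>
      RingHom.equivRatAlgHom K ℂ (embedding w.1) := by
  refine (RingHom.equivRatAlgHom K ℂ).bijective.comp
    (f := fun w : {w : InfinitePlace K // w.IsReal} => embedding w.1) ⟨fun v w h => ?_, fun φ => ?_⟩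
  · exact Subtype.ext (by simpa using congrArg InfinitePlace.mk h)
  · exact ⟨⟨InfinitePlace.mk φ, htr _⟩,
      embedding_mk_eq_of_isReal (isReal_of_mk_isReal (htr _))⟩

open scoped Classical in
lemma trace_eq_sum_real_places (htr : TotallyReal K) (x : K) :
    (Algebra.trace ℚ K x : ℝ) =
      ∑ w : {w : InfinitePlace K // w.IsReal}, embedding_of_isReal w.2 x := by
  have h := trace_eq_sum_embeddings (K := ℚ) (L := K) ℂ (x := x)
  rw [← (bijective_equivRatAlgHom_embedding_real_place htr).sum_comp fun σ => σ x,
    eq_ratCast] at h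
  apply Complex.ofReal_injective
  push_cast
  rw [h]
  simp

open scoped Classical in
lemma norm_eq_prod_real_places (htr : TotallyReal K) (x : K) :
    (Algebra.norm ℚ x : ℝ) =
      ∏ w : {w : InfinitePlace K // w.IsReal}, embedding_of_isReal w.2 x := by
  have h := Algebra.norm_eq_prod_embeddings ℚ ℂ x
  rw [← (bijective_equivRatAlgHom_embedding_real_place htr).prod_comp fun σ => σ x,
    eq_ratCast] at h
  apply Complex.ofReal_injective
  push_cast
  rw [h]
  simp

open scoped Classical in
lemma card_real_places_eq_finrank (htr : TotallyReal K) :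
    Fintype.card {w : InfinitePlace K // w.IsReal} = Module.finrank ℚ K := by
  rw [Fintype.card_of_bijective (bijective_equivRatAlgHom_embedding_real_place htr),
    AlgHom.card]

open scoped Classical in
lemma lintegral_fst_mixedSpace (htr : TotallyReal K)
    {f : ({w : InfinitePlace K // w.IsReal} → ℝ) → ENNReal} (hf : Measurable f) :
    ∫⁻ y : mixedSpace K, f y.1 = ∫⁻ y, f y := by
  have : IsEmpty {w : InfinitePlace K // w.IsComplex} :=
    ⟨fun w => not_isReal_iff_isComplex.mpr w.2 (htr w.1)⟩
  have : IsProbabilityMeasure (volume : Measure ({w : InfinitePlace K // w.IsComplex} → ℂ)) := by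
    rw [Measure.volume_pi_eq_dirac]
    infer_instance
  exact measurePreserving_fst.lintegral_comp hf

open scoped Classical in
lemma volume_fundamentalDomain_latticeBasis_of_totallyReal (htr : TotallyReal K) :
    volume (ZSpan.fundamentalDomain (latticeBasis K)) = ENNReal.ofReal √|(discr K : ℝ)| := by
  have : IsTotallyReal K := ⟨htr⟩
  rw [volume_fundamentalDomain_latticeBasis, nrComplexPlaces_eq_zero_iff.mpr this, pow_zero,
    one_mul, ← ENNReal.ofReal_coe_nnreal, Real.coe_sqrt, coe_nnnorm, Int.norm_eq_abs]

open scoped Classical in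
lemma prod_inv_mul_le_sqrt_abs_discr (htr : TotallyReal K)
    (d : {w : InfinitePlace K // w.IsReal} → ℝ) (hd : ∀ w, 0 < d w)
    (hmin : ∀ z : 𝓞 K, z ≠ 0 → 2 ≤ ∑ w, (d w * embedding_of_isReal w.2 (z : K)) ^ 2) :
    (∏ w, d w)⁻¹ * (π ^ ((Module.finrank ℚ K : ℝ) / 2) /
      Gamma (2 + (Module.finrank ℚ K : ℝ) / 2)) ≤ √|(discr K : ℝ)| := by
  have : Nonempty {w : InfinitePlace K // w.IsReal} :=
    (inferInstance : Nonempty (InfinitePlace K)).map fun w => ⟨w, htr w⟩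
  let T : mixedSpace K →+ EuclideanSpace ℝ {w : InfinitePlace K // w.IsReal} :=
    { toFun := fun v => WithLp.toLp 2 fun w => d w * v.1 w
      map_zero' := by ext; simp
      map_add' := fun u v => by ext; simp [mul_add] }
  have h := lintegral_ofReal_one_sub_norm_sq_le_measure
    (Submodule.span ℤ (Set.range (latticeBasis K)))
    (ZSpan.isAddFundamentalDomain (latticeBasis K) volume) T
    (by simp only [T, AddMonoidHom.coe_mk, ZeroHom.coe_mk]; fun_prop) ?_
  · have hint := (lintegral_fst_mixedSpace htr (f := fun y =>
      ENNReal.ofReal (1 - ‖WithLp.toLp 2 fun w => d w * y w‖ ^ 2)) (by fun_prop)).trans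
        (lintegral_ofReal_one_sub_sum_sq d hd)
    rw [volume_fundamentalDomain_latticeBasis_of_totallyReal htr] at h
    have h' := hint.symm.trans_le h
    have hpos : 0 < ∏ w, d w := Finset.prod_pos fun w _ => hd w
    rw [← ENNReal.ofReal_mul (by positivity), ENNReal.ofReal_le_ofReal_iff (by positivity),
      card_real_places_eq_finrank htr] at h'
    exact h'
  · intro v hv hv0
    obtain ⟨z, rfl⟩ := (mem_span_latticeBasis K).mp hv
    have hz : z ≠ 0 := by
      rintro rfl
      exact hv0 (by simp)
    convert hmin z hz
    simp [T, EuclideanSpace.real_norm_sq_eq, mixedEmbedding_apply_isReal]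

/-- For totally positive `a`, a nonzero `x` minimising the trace form has bounded norm. -/
lemma abs_norm_le_of_trForm_le (htr : TotallyReal K) {a : K} (ha : TotPos a) {x : 𝓞 K}
    (hx : x ≠ 0) (hmin : ∀ z : 𝓞 K, z ≠ 0 → (trForm a x : ℝ) ≤ trForm a z) :
    |(Algebra.norm ℚ (x : K) : ℝ)| ≤ (2 / Module.finrank ℚ K) ^ ((Module.finrank ℚ K : ℝ) / 2) *
      (√|(discr K : ℝ)| * (Gamma (2 + (Module.finrank ℚ K : ℝ) / 2) /
        π ^ ((Module.finrank ℚ K : ℝ) / 2))) := by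
  classical
  have : Nonempty {w : InfinitePlace K // w.IsReal} :=
    (inferInstance : Nonempty (InfinitePlace K)).map fun w => ⟨w, htr w⟩
  have htrace : ∀ z : 𝓞 K, (trForm a z : ℝ) = ∑ w : {w : InfinitePlace K // w.IsReal},
      embedding_of_isReal w.2 a * embedding_of_isReal w.2 (z : K) ^ 2 := fun z => by
    simp [trForm, trace_eq_sum_real_places htr]
  have hm : 0 < (trForm a x : ℝ) := by
    rw [htrace]
    refine Finset.sum_pos (fun w _ => mul_pos (ha _) (sq_pos_iff.mpr ?_)) Finset.univ_nonempty
    simpa using hx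
  set m : ℝ := (trForm a x : ℝ) with hm_def
  let d : {w : InfinitePlace K // w.IsReal} → ℝ := fun w => √(2 / m * embedding_of_isReal w.2 a)
  have hd : ∀ w, 0 < d w := fun w => sqrt_pos.mpr (mul_pos (by positivity) (ha _))
  have hsum : ∀ z : 𝓞 K, ∑ w, (d w * embedding_of_isReal w.2 (z : K)) ^ 2 =
      2 / m * trForm a z := fun z => by
    rw [htrace, Finset.mul_sum]
    refine Finset.sum_congr rfl fun w _ => ?_
    rw [mul_pow, sq_sqrt (mul_pos (by positivity) (ha _)).le, mul_assoc]
  have hvol := prod_inv_mul_le_sqrt_abs_discr htr d hd fun z hz => by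
    rw [hsum, div_mul_eq_mul_div, le_div_iff₀ hm]
    exact mul_le_mul_of_nonneg_left (hmin z hz) zero_le_two
  have hamgm := abs_prod_le_rpow_sum_sq_div_card
    fun w : {w : InfinitePlace K // w.IsReal} => d w * embedding_of_isReal w.2 (x : K)
  have hpos : 0 < ∏ w, d w := Finset.prod_pos fun w _ => hd w
  have hG : 0 < Gamma (2 + (Module.finrank ℚ K : ℝ) / 2) := Gamma_pos_of_pos (by positivity)
  rw [hsum, ← hm_def, div_mul_cancel₀ _ hm.ne', Finset.prod_mul_distrib,
    ← norm_eq_prod_real_places htr, abs_mul, abs_of_pos hpos, card_real_places_eq_finrank htr,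
    ← le_div_iff₀' hpos, div_eq_mul_inv] at hamgm
  refine hamgm.trans (mul_le_mul_of_nonneg_left ?_ (by positivity))
  rwa [← div_le_iff₀ (by positivity), div_div_eq_mul_div, mul_div_assoc]

end NumberField

lemma trForm_nonneg_s10 {K : Type*} [Field K] [NumberField K] (htr : TotallyReal K) {a : K}
    (ha : TotPos a) (z : 𝓞 K) : (0 : ℝ) ≤ trForm a z := by
  classical
  rw [trForm, NumberField.trace_eq_sum_real_places htr]
  refine Finset.sum_nonneg fun w _ => ?_
  rw [map_mul, map_pow]
  exact mul_nonneg (ha _).le (sq_nonneg _)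

lemma trForm_le_of_mem_minVecs {K : Type*} [Field K] [NumberField K] (htr : TotallyReal K) {a : K}
    (ha : TotPos a) {x : 𝓞 K} (hx : x ∈ MinVecs a) {z : 𝓞 K} (hz : z ≠ 0) :
    (trForm a x : ℝ) ≤ trForm a z := by
  rw [show (trForm a x : ℝ) = muMin a from hx]
  refine csInf_le ⟨0, ?_⟩ ⟨z, hz, rfl⟩
  rintro _ ⟨y, -, rfl⟩
  exact trForm_nonneg_s10 htr ha y

/-- Every totally real number field of degree n is A-reducible with
A bounded by the stated quantity: minimal vectors have small norm. -/
theorem norm_minimal_vector_bound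
    (K : Type*) [Field K] [NumberField K] (n : ℕ)
    (hdeg : Module.finrank ℚ K = n) (htr : TotallyReal K) :
    (∀ a : K, TotPos a → ∀ x ∈ MinVecs a,
      |(Algebra.norm ℚ (x : K) : ℝ)| ≤
        (n : ℝ) ^ (-(n : ℝ) / 2) * Real.sqrt |(NumberField.discr K : ℝ)| *
          (2 / π) ^ ((n : ℝ) / 2) * Real.Gamma (2 + (n : ℝ) / 2)) ∧
    IsAReducible K ((n : ℝ) ^ (-(n : ℝ) / 2) * Real.sqrt |(NumberField.discr K : ℝ)| *
        (2 / π) ^ ((n : ℝ) / 2) * Real.Gamma (2 + (n : ℝ) / 2)) := by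
  have bound : ∀ a : K, TotPos a → ∀ x ∈ MinVecs a,
      |(Algebra.norm ℚ (x : K) : ℝ)| ≤
        (n : ℝ) ^ (-(n : ℝ) / 2) * Real.sqrt |(NumberField.discr K : ℝ)| *
          (2 / π) ^ ((n : ℝ) / 2) * Real.Gamma (2 + (n : ℝ) / 2) := by
    intro a ha x hx
    have hG : 0 < Real.Gamma (2 + (n : ℝ) / 2) := Gamma_pos_of_pos (by positivity)
    rcases eq_or_ne x 0 with rfl | hx0
    · simp only [map_zero, Algebra.norm_zero, Rat.cast_zero, abs_zero]
      positivity
    · refine (NumberField.abs_norm_le_of_trForm_le htr ha hx0 fun z hz =>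
        trForm_le_of_mem_minVecs htr ha hx hz).trans_eq ?_
      rw [hdeg, div_rpow two_pos.le n.cast_nonneg, div_rpow two_pos.le pi_pos.le, neg_div,
        rpow_neg n.cast_nonneg]
      ring
  exact ⟨bound, bound⟩
end
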